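/- Let k, l ≥ 1 be integers, p = 1/k, ε > 0, and n a positive integer. Let X be a set of size l. There exist η > 0 and a function f from subsets of X to subsets of the colour set {1, ..., ⌊(p/2 - p^l/2 - ε)n⌋} such that |f(X')| ≤ ⌈p^{|X'|}(1-p)^{l-|X'|}(1-η)n/2⌉ for every X' ⊆ X, and for every x ∈ X the union of f(X') over all X' with x ∈ X' ⊆ X equals the whole colour set {1, ..., ⌊(p/2 - p^l/2 - ε)n⌋}. -/

import Mathlib

open Finset

/-- A real vector can be rounded, within the integer floors and ceilings of its entries and
preserving a linear map, until that map is injective on the non-integral coordinates. -/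
theorem exists_round_injective {Λ V : Type*} [Fintype Λ] [AddCommGroup V] [Module ℝ V]
    (φ : (Λ → ℝ) →ₗ[ℝ] V) (x : Λ → ℝ) :
    ∃ z : Λ → ℝ, φ z = φ x ∧ (∀ i, (⌊x i⌋ : ℝ) ≤ z i ∧ z i ≤ ⌈x i⌉) ∧
      ∀ d : Λ → ℝ, φ d = 0 → (∀ i, (∃ a : ℤ, z i = a) → d i = 0) → d = 0 := by
  classical
  induction h : (univ.filter fun i => ¬ ∃ a : ℤ, x i = a).card using
    Nat.strong_induction_on generalizing x with
  | _ N ih =>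
  subst h
  by_cases hd : ∃ d : Λ → ℝ, φ d = 0 ∧ (∀ i, (∃ a : ℤ, x i = a) → d i = 0) ∧ d ≠ 0
  swap
  · refine ⟨x, rfl, fun i => ⟨Int.floor_le _, Int.le_ceil _⟩, fun d h1 h2 => ?_⟩
    by_contra h3
    exact hd ⟨d, h1, h2, h3⟩
  obtain ⟨d, hd0, hdi, hdne⟩ := hd
  obtain ⟨i₁, hi₁⟩ : ∃ i, d i ≠ 0 := by
    by_contra! hc
    exact hdne (funext hc)
  let τ : Λ → ℝ := fun i => if 0 < d i then (⌈x i⌉ - x i) / d i else (x i - ⌊x i⌋) / (- d i)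
  obtain ⟨i₀, hi₀, hmin⟩ := exists_min_image (univ.filter fun i => d i ≠ 0) τ ⟨i₁, by simp [hi₁]⟩
  have hi₀' : d i₀ ≠ 0 := by simpa using hi₀
  have hτ : ∀ i, 0 ≤ τ i := by
    intro i
    simp only [τ]
    split_ifs with h
    · exact div_nonneg (sub_nonneg.2 (Int.le_ceil _)) h.le
    · exact div_nonneg (sub_nonneg.2 (Int.floor_le _)) (by linarith)
  let y : Λ → ℝ := fun i => x i + τ i₀ * d i
  have hy : ∀ i, (⌊x i⌋ : ℝ) ≤ y i ∧ y i ≤ ⌈x i⌉ := by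
    intro i
    have hf := Int.floor_le (x i)
    have hc := Int.le_ceil (x i)
    rcases lt_trichotomy (d i) 0 with h | h | h
    · have hm := hmin i (by simp [h.ne])
      have h' : ¬ 0 < d i := not_lt.2 h.le
      simp only [τ, if_neg h'] at hm
      change τ i₀ ≤ _ at hm
      rw [le_div_iff₀ (by linarith)] at hm
      have := mul_nonpos_of_nonneg_of_nonpos (hτ i₀) h.le
      constructor <;> simp only [y] <;> linarith
    · simp only [y, h, mul_zero, add_zero]
      exact ⟨hf, hc⟩
    · have hm := hmin i (by simp [h.ne'])
      simp only [τ, if_pos h] at hm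
      change τ i₀ ≤ _ at hm
      rw [le_div_iff₀ h] at hm
      have := mul_nonneg (hτ i₀) h.le
      constructor <;> simp only [y] <;> linarith
  have hyint : ∃ a : ℤ, y i₀ = a := by
    simp only [y, τ]
    split_ifs with h
    · exact ⟨⌈x i₀⌉, by field_simp; ring⟩
    · exact ⟨⌊x i₀⌋, by field_simp; ring⟩
  have hlt : (univ.filter fun i => ¬ ∃ a : ℤ, y i = a).card <
      (univ.filter fun i => ¬ ∃ a : ℤ, x i = a).card := by
    apply card_lt_card
    rw [ssubset_iff_of_subset]
    · refine ⟨i₀, ?_, by simpa using hyint⟩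
      simp only [mem_filter, mem_univ, true_and]
      exact fun h => hi₀' (hdi _ h)
    · intro i hi
      simp only [mem_filter, mem_univ, true_and] at hi ⊢
      intro h
      apply hi
      simpa [y, hdi i h] using h
  obtain ⟨z, hz1, hz2, hz3⟩ := ih _ hlt y rfl
  refine ⟨z, ?_, fun i => ⟨?_, ?_⟩, hz3⟩
  · have : y = x + τ i₀ • d := by
      ext i
      simp [y]
    rw [hz1, this, map_add, map_smul, hd0, smul_zero, add_zero]
  · refine le_trans ?_ (hz2 i).1
    exact_mod_cast Int.le_floor.2 (hy i).1
  · refine le_trans (hz2 i).2 ?_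
    exact_mod_cast Int.ceil_le.2 (hy i).2

/-- If a finite real sum is an integer, then a non-integral term is never the only one. -/
theorem exists_ne_of_sum_eq_int {K : Type*} [Fintype K] (f : K → ℝ) (hf : ∃ a : ℤ, ∑ k, f k = a)
    (k₀ : K) (hk₀ : ¬ ∃ a : ℤ, f k₀ = a) : ∃ k, k ≠ k₀ ∧ ¬ ∃ a : ℤ, f k = a := by
  by_contra! hall
  apply hk₀
  obtain ⟨a, ha⟩ := hf
  have : ∀ k, ∃ b : ℤ, k ≠ k₀ → f k = b := by
    intro k
    by_cases h : k = k₀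
    · exact ⟨0, fun h' => absurd h h'⟩
    · obtain ⟨b, hb⟩ := hall k h
      exact ⟨b, fun _ => hb⟩
  choose b hb using this
  classical
  rw [← add_sum_erase _ _ (mem_univ k₀)] at ha
  refine ⟨a - ∑ k ∈ univ.erase k₀, b k, ?_⟩
  push_cast
  rw [← ha, sum_congr rfl fun k hk => hb k (ne_of_mem_erase hk)]
  ring

/-- A real matrix with integral row and column sums can be rounded to an integral matrix with the
same row and column sums. -/
theorem exists_int_matrix {I J : Type*} [Fintype I] [Fintype J] (x : I → J → ℝ)
    (hr : ∀ i, ∃ a : ℤ, ∑ j, x i j = a) (hc : ∀ j, ∃ a : ℤ, ∑ i, x i j = a) :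
    ∃ z : I → J → ℤ, (∀ i j, ⌊x i j⌋ ≤ z i j ∧ z i j ≤ ⌈x i j⌉) ∧
      (∀ i, ∑ j, (z i j : ℝ) = ∑ j, x i j) ∧ ∀ j, ∑ i, (z i j : ℝ) = ∑ i, x i j := by
  classical
  let φ : (I × J → ℝ) →ₗ[ℝ] (I → ℝ) × (J → ℝ) :=
    { toFun := fun f => (fun i => ∑ j, f (i, j), fun j => ∑ i, f (i, j))
      map_add' := by intro f g; ext <;> simp [sum_add_distrib]
      map_smul' := by intro c f; ext <;> simp [mul_sum] }
  obtain ⟨z, hz1, hz2, hz3⟩ := exists_round_injective φ (fun p => x p.1 p.2)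
  have hrow : ∀ i, ∑ j, z (i, j) = ∑ j, x i j := fun i => congrFun (congrArg Prod.fst hz1) i
  have hcol : ∀ j, ∑ i, z (i, j) = ∑ i, x i j := fun j => congrFun (congrArg Prod.snd hz1) j
  suffices hzint : ∀ p, ∃ a : ℤ, z p = a by
    choose a ha using hzint
    refine ⟨fun i j => a (i, j), fun i j => ?_, fun i => ?_, fun j => ?_⟩
    · have := hz2 (i, j)
      rw [ha] at this
      exact_mod_cast this
    · simp only [← ha, hrow]
    · simp only [← ha, hcol]
  by_contra! hne
  obtain ⟨p₀, hp₀⟩ := hne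
  let F : Finset (I × J) := univ.filter fun p => ¬ ∃ a : ℤ, z p = a
  have hF : ∀ p, p ∈ F ↔ ¬ ∃ a : ℤ, z p = a := fun p => by simp [F]
  have hp₀F : p₀ ∈ F := by
    rw [hF]
    push Not
    exact hp₀
  let R := F.image Prod.fst
  let C := F.image Prod.snd
  have hR : 2 * R.card ≤ F.card := by
    rw [mul_comm, ← smul_eq_mul]
    refine (card_nsmul_le_sum R _ 2 ?_).trans_eq
      (card_eq_sum_card_image Prod.fst F).symm
    intro i hi
    obtain ⟨⟨i', j⟩, hp, rfl⟩ := mem_image.1 hi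
    obtain ⟨j', hj', hj'2⟩ := exists_ne_of_sum_eq_int (fun j => z (i', j))
      (by rw [hrow]; exact hr _) j ((hF _).1 hp)
    have : ({(i', j), (i', j')} : Finset (I × J)) ⊆ F.filter (fun p => p.1 = i') := by
      intro p hp'
      simp only [mem_insert, mem_singleton] at hp'
      rcases hp' with rfl | rfl
      · simp [hp]
      · simp [hF, hj'2]
    refine le_trans ?_ (card_le_card this)
    rw [card_pair]
    simpa using hj'.symm
  have hC : 2 * C.card ≤ F.card := by
    rw [mul_comm, ← smul_eq_mul]
    refine (card_nsmul_le_sum C _ 2 ?_).trans_eq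
      (card_eq_sum_card_image Prod.snd F).symm
    intro j hj
    obtain ⟨⟨i, j'⟩, hp, rfl⟩ := mem_image.1 hj
    obtain ⟨i', hi', hi'2⟩ := exists_ne_of_sum_eq_int (fun i => z (i, j'))
      (by rw [hcol]; exact hc _) i ((hF _).1 hp)
    have : ({(i, j'), (i', j')} : Finset (I × J)) ⊆ F.filter (fun p => p.2 = j') := by
      intro p hp'
      simp only [mem_insert, mem_singleton] at hp'
      rcases hp' with rfl | rfl
      · simp [hp]
      · simp [hF, hi'2]
    refine le_trans ?_ (card_le_card this)
    rw [card_pair]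
    simpa using hi'.symm
  let ψ : (F → ℝ) →ₗ[ℝ] (I × J → ℝ) :=
    { toFun := fun f p => if h : p ∈ F then f ⟨p, h⟩ else 0
      map_add' := by intro f g; ext p; by_cases h : p ∈ F <;> simp [h]
      map_smul' := by intro c f; ext p; by_cases h : p ∈ F <;> simp [h] }
  let R' := R.erase p₀.1
  let ρ : (F → ℝ) →ₗ[ℝ] (R' → ℝ) × (C → ℝ) :=
    { toFun := fun f => (fun i => (φ (ψ f)).1 i, fun j => (φ (ψ f)).2 j)
      map_add' := by intro f g; ext <;> simp
      map_smul' := by intro c f; ext <;> simp }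
  have hinj : Function.Injective ρ := by
    rw [← LinearMap.ker_eq_bot, LinearMap.ker_eq_bot']
    intro f hf
    have h1 : ∀ i ∈ R', (φ (ψ f)).1 i = 0 := fun i hi => congrFun (congrArg Prod.fst hf) ⟨i, hi⟩
    have h2 : ∀ j ∈ C, (φ (ψ f)).2 j = 0 := fun j hj => congrFun (congrArg Prod.snd hf) ⟨j, hj⟩
    have h2' : ∀ j, (φ (ψ f)).2 j = 0 := by
      intro j
      by_cases hj : j ∈ C
      · exact h2 j hj
      · refine sum_eq_zero fun i _ => ?_
        have : (i, j) ∉ F := fun h => hj (mem_image_of_mem Prod.snd h)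
        simp [ψ, this]
    have h1' : ∀ i, i ≠ p₀.1 → (φ (ψ f)).1 i = 0 := by
      intro i hi
      by_cases hi' : i ∈ R
      · exact h1 i (mem_erase.2 ⟨hi, hi'⟩)
      · refine sum_eq_zero fun j _ => ?_
        have : (i, j) ∉ F := fun h => hi' (mem_image_of_mem Prod.fst h)
        simp [ψ, this]
    have htot : ∑ i, (φ (ψ f)).1 i = ∑ j, (φ (ψ f)).2 j := sum_comm
    have h0 : (φ (ψ f)).1 p₀.1 = 0 := by
      rw [sum_eq_zero fun j _ => h2' j, ← add_sum_erase _ _ (mem_univ p₀.1),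
        sum_eq_zero fun i hi => h1' i (ne_of_mem_erase hi), add_zero] at htot
      exact htot
    have hψ : ψ f = 0 := by
      apply hz3
      · ext i
        · by_cases hi : i = p₀.1
          · rw [hi]; exact h0
          · exact h1' i hi
        · exact h2' i
      · intro p hp
        have : p ∉ F := by rw [hF]; exact not_not.2 hp
        simp [ψ, this]
    ext p
    have := congrFun hψ p.1
    simpa [ψ, p.2] using this
  have hrank := LinearMap.finrank_le_finrank_of_injective hinj
  simp only [Module.finrank_prod, Module.finrank_fintype_fun_eq_card, Fintype.card_coe] at hrank
  have hmem : p₀.1 ∈ R := mem_image_of_mem Prod.fst hp₀F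
  have := card_erase_lt_of_mem hmem
  change F.card ≤ R'.card + C.card at hrank
  change R'.card < R.card at this
  omega

/-- A real matrix with integral column sums can be rounded to an integral matrix with the same
column sums, all of whose row sums are rounded. -/
theorem exists_int_matrix_of_col {I J : Type*} [Fintype I] [Fintype J] (x : I → J → ℝ)
    (hc : ∀ j, ∃ a : ℤ, ∑ i, x i j = a) :
    ∃ z : I → J → ℤ, (∀ i j, ⌊x i j⌋ ≤ z i j ∧ z i j ≤ ⌈x i j⌉) ∧
      (∀ i, ⌊∑ j, x i j⌋ ≤ ∑ j, z i j ∧ ∑ j, z i j ≤ ⌈∑ j, x i j⌉) ∧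
      ∀ j, ∑ i, (z i j : ℝ) = ∑ i, x i j := by
  choose a ha using hc
  let y : I → Option J → ℝ := fun i o => o.elim (⌈∑ j, x i j⌉ - ∑ j, x i j) (x i)
  obtain ⟨z, hz1, hz2, hz3⟩ := exists_int_matrix y
    (fun i => ⟨⌈∑ j, x i j⌉, by simp [y, Fintype.sum_option]⟩) (by
      rintro (_ | j)
      · refine ⟨∑ i, ⌈∑ j, x i j⌉ - ∑ j, a j, ?_⟩
        simp only [y, Option.elim, sum_sub_distrib]
        rw [sum_comm (f := fun i j => x i j)]
        simp [ha]
      · exact ⟨a j, ha j⟩)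
  refine ⟨fun i j => z i (some j), fun i j => hz1 i (some j), fun i => ?_, fun j => hz3 (some j)⟩
  have h1 := hz2 i
  have h2 := hz1 i none
  simp only [y, Fintype.sum_option, Option.elim, sub_add_cancel] at h1 h2
  have h3 : z i none + ∑ j, z i (some j) = ⌈∑ j, x i j⌉ := by exact_mod_cast h1
  have h4 := Int.le_ceil (∑ j, x i j)
  have h5 : (0 : ℤ) ≤ z i none := le_trans (Int.floor_nonneg.2 (by linarith)) h2.1
  have h6 : z i none ≤ ⌈∑ j, x i j⌉ - ⌊∑ j, x i j⌋ := by
    refine h2.2.trans (Int.ceil_le.2 ?_)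
    push_cast
    linarith [Int.floor_le (∑ j, x i j)]
  constructor <;> linarith

/-- One round of Baranyai's edge-by-edge construction: the items `A b T r` of residual size `r` in
bin `b` are split into those (`e`) receiving the next element and the others. -/
theorem exists_fair_split {I τ : Type*} [Fintype I] (P : Finset τ) (u : ℕ) (A : I → τ → ℕ → ℕ)
    (C : τ → ℕ → ℕ) (hA : ∀ T ∈ P, ∀ r, ∑ b, A b T r = (u + 1).choose r * C T r) :
    ∃ e : I → τ → ℕ → ℕ, (∀ b, ∀ T ∈ P, ∀ r, e b T r ≤ A b T r) ∧ (∀ b T, e b T 0 = 0) ∧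
      (∀ T ∈ P, ∀ r, ∑ b, e b T (r + 1) = u.choose r * C T (r + 1)) ∧
      ∀ b, u + 1 ≤ ∑ T ∈ P, ∑ r ∈ range (u + 2), r * A b T r →
        1 ≤ ∑ T ∈ P, ∑ r ∈ range (u + 2), e b T r ∧
        (∑ T ∈ P, ∑ r ∈ range (u + 2), e b T r) + u ≤
          ∑ T ∈ P, ∑ r ∈ range (u + 2), r * A b T r := by
  classical
  have ht : (0 : ℝ) < u + 1 := by positivity
  let x : I → P × Fin (u + 2) → ℝ := fun b j => (j.2 : ℕ) * A b j.1 j.2 / (u + 1)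
  have hcol0 : ∀ (T : P) (h : 0 < u + 2), ∑ b, x b (T, ⟨0, h⟩) = 0 := by
    intro T h
    simp [x]
  have hcol1 : ∀ (T : P) r (h : r + 1 < u + 2),
      ∑ b, x b (T, ⟨r + 1, h⟩) = ((u.choose r * C T (r + 1) : ℕ) : ℝ) := by
    intro T r h
    have h1 := hA T.1 T.2 (r + 1)
    have h2 := Nat.add_one_mul_choose_eq u r
    simp only [x]
    rw [← sum_div, ← mul_sum, ← Nat.cast_sum, h1, div_eq_iff ht.ne']
    have h3 : ((u + 1 : ℕ) : ℝ) * u.choose r = (u + 1).choose (r + 1) * (r + 1 : ℕ) := by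
      exact_mod_cast h2
    push_cast at h3 ⊢
    linear_combination (-(C T (r + 1) : ℝ)) * h3
  obtain ⟨z, hz1, hz2, hz3⟩ := exists_int_matrix_of_col x (by
    rintro ⟨T, r, hr⟩
    rcases r with _ | r
    · exact ⟨0, by rw [hcol0]; simp⟩
    · exact ⟨_, (hcol1 T r hr).trans (Int.cast_natCast _).symm⟩)
  have hz0 : ∀ b j, 0 ≤ z b j := fun b j =>
    le_trans (Int.floor_nonneg.2 (by simp only [x]; positivity)) (hz1 b j).1
  let e : I → τ → ℕ → ℕ := fun b T r =>
    if h : T ∈ P ∧ r < u + 2 then (z b (⟨T, h.1⟩, ⟨r, h.2⟩)).toNat else 0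
  have he : ∀ b (T : P) (r : Fin (u + 2)), (e b T r : ℤ) = z b (T, r) := by
    intro b T r
    have : (T : τ) ∈ P ∧ (r : ℕ) < u + 2 := ⟨T.2, r.2⟩
    simp only [e, dif_pos this]
    exact Int.toNat_of_nonneg (hz0 _ _)
  have hsum : ∀ g : τ → ℕ → ℕ, ∑ T ∈ P, ∑ r ∈ range (u + 2), g T r =
      ∑ j : P × Fin (u + 2), g j.1 j.2 := by
    intro g
    rw [Fintype.sum_prod_type, ← sum_coe_sort P]
    simp only [sum_range]
  refine ⟨e, fun b T hT r => ?_, fun b T => ?_, fun T hT r => ?_, fun b hb => ?_⟩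
  · by_cases hr : r < u + 2
    · have h1 := he b ⟨T, hT⟩ ⟨r, hr⟩
      have h2 := (hz1 b (⟨T, hT⟩, ⟨r, hr⟩)).2
      have h3 : ⌈x b (⟨T, hT⟩, ⟨r, hr⟩)⌉ ≤ (A b T r : ℤ) := by
        rw [Int.ceil_le]
        simp only [x]
        rw [div_le_iff₀ ht]
        have : (r : ℝ) ≤ u + 1 := by exact_mod_cast Nat.lt_succ_iff.1 hr
        push_cast
        nlinarith [(Nat.cast_nonneg (A b T r) : (0 : ℝ) ≤ _)]
      simp only at h1
      omega
    · simp [e, hr]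
  · by_cases hT : T ∈ P
    · have h1 := he b ⟨T, hT⟩ ⟨0, by omega⟩
      have h2 := (hz1 b (⟨T, hT⟩, ⟨0, by omega⟩)).2
      simp only [x, CharP.cast_eq_zero, zero_mul, zero_div, Int.ceil_zero] at h2
      simp only at h1
      omega
    · simp [e, hT]
  · by_cases hr : r + 1 < u + 2
    · have h1 := hz3 (⟨T, hT⟩, ⟨r + 1, hr⟩)
      rw [hcol1] at h1
      have h2 : ∑ b, (e b T (r + 1) : ℤ) = ((u.choose r * C T (r + 1) : ℕ) : ℤ) := by
        rw [sum_congr rfl fun b _ => he b ⟨T, hT⟩ ⟨r + 1, hr⟩]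
        exact_mod_cast h1
      exact_mod_cast h2
    · rw [Nat.choose_eq_zero_of_lt (by omega), zero_mul]
      exact sum_eq_zero fun b _ => by simp [e, hr]
  · rw [hsum] at hb ⊢
    rw [hsum fun T r => r * A b T r]
    set W := ∑ j : P × Fin (u + 2), (j.2 : ℕ) * A b j.1 j.2 with hW
    have hx : ∑ j, x b j = W / (u + 1) := by
      rw [hW]
      push_cast
      rw [sum_div]
    have hE : ((∑ j : P × Fin (u + 2), e b j.1 j.2 : ℕ) : ℤ) = ∑ j, z b j := by
      push_cast
      exact sum_congr rfl fun j _ => he b j.1 j.2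
    obtain ⟨h1, h2⟩ := hz2 b
    rw [hx, ← hE] at h1 h2
    have hWr : ((u : ℝ) + 1) ≤ W := by exact_mod_cast hb
    have h3 : (1 : ℤ) ≤ ⌊(W : ℝ) / (u + 1)⌋ := by
      rw [Int.le_floor, le_div_iff₀ ht]
      simpa using hWr
    have h4 : ⌈(W : ℝ) / (u + 1)⌉ ≤ (W : ℤ) - u := by
      rw [Int.ceil_le, div_le_iff₀ ht]
      push_cast
      nlinarith [(Nat.cast_nonneg u : (0 : ℝ) ≤ u)]
    constructor <;> omega

theorem exists_cover_of_bins {α : Type*} [Fintype α] [DecidableEq α] (D : ℕ) (c : ℕ → ℕ)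
    (a : Fin D → ℕ → ℕ) (hcap : ∀ m, ∑ b, a b m ≤ (Fintype.card α).choose m * c m)
    (hbin : ∀ b, Fintype.card α ≤ ∑ m ∈ range (Fintype.card α + 1), m * a b m) :
    ∃ f : Finset α → Finset (Fin D), (∀ Y, (f Y).card ≤ c Y.card) ∧
      ∀ x b, ∃ Y, x ∈ Y ∧ b ∈ f Y := by
  suffices key : ∀ S : Finset α, ∃ A : Option (Fin D) → Finset α → ℕ → ℕ,
      (∀ T ∈ S.powerset, ∀ r, ∑ b, A b T r = (Fintype.card α - S.card).choose r * c (r + T.card)) ∧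
      (∀ b, ∀ x ∈ S, ∃ T ∈ S.powerset, x ∈ T ∧ ∃ r, 0 < A (some b) T r) ∧
      ∀ b, Fintype.card α - S.card ≤ ∑ T ∈ S.powerset,
        ∑ r ∈ range (Fintype.card α - S.card + 1), r * A (some b) T r by
    obtain ⟨A, h1, h2, -⟩ := key univ
    simp only [card_univ, Nat.sub_self] at h1
    refine ⟨fun Y => univ.filter fun b => 0 < A (some b) Y 0, fun Y => ?_, fun x b => ?_⟩
    · have h := h1 Y (by simp) 0
      rw [Nat.choose_zero_right, one_mul, zero_add, Fintype.sum_option] at h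
      rw [card_eq_sum_ones, sum_filter, ← h]
      refine le_trans (sum_le_sum fun b _ => ?_) (Nat.le_add_left _ _)
      split_ifs <;> omega
    · obtain ⟨T, hT, hx, r, hr⟩ := h2 b x (mem_univ _)
      refine ⟨T, hx, ?_⟩
      rcases r with _ | r
      · simpa using hr
      · have h := h1 T hT (r + 1)
        rw [Nat.choose_zero_succ, zero_mul, sum_eq_zero_iff] at h
        exact absurd (h (some b) (mem_univ _)) hr.ne'
  intro S
  induction S using Finset.induction_on with
  | empty =>
    refine ⟨fun b T r => b.elim ((Fintype.card α).choose r * c r - ∑ b, a b r) (fun b => a b r),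
      ?_, by simp, ?_⟩
    · intro T hT r
      simp only [powerset_empty, mem_singleton] at hT
      subst hT
      have := hcap r
      simp [Fintype.sum_option, this]
    · intro b
      simpa using hbin b
  | insert x S hx ih =>
    obtain ⟨A, h1, h2, h3⟩ := ih
    have hlt : S.card < Fintype.card α := card_lt_univ_of_notMem hx
    obtain ⟨u, hu⟩ : ∃ u, Fintype.card α - S.card = u + 1 := ⟨Fintype.card α - S.card - 1, by omega⟩
    have hu' : Fintype.card α - (insert x S).card = u := by
      rw [card_insert_of_notMem hx]
      omega
    rw [hu] at h1 h3
    rw [hu']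
    obtain ⟨e, he1, he2, he3, he4⟩ := exists_fair_split S.powerset u A
      (fun T r => c (r + T.card)) h1
    have hxT : ∀ T ∈ S.powerset, x ∉ T := fun T hT h => hx (mem_powerset.1 hT h)
    have hrest : ∀ T ∈ S.powerset, ∀ r,
        ∑ b, (A b T r - e b T r) = u.choose r * c (r + T.card) := by
      intro T hT r
      rw [sum_tsub_distrib _ fun b _ => he1 b T hT r, h1 T hT]
      rcases r with _ | r
      · simp [he2]
      · rw [he3 T hT, Nat.choose_succ_succ, ← Nat.sub_mul, Nat.add_sub_cancel_left]
    refine ⟨fun b T r => if x ∈ T then e b (T.erase x) (r + 1) else A b T r - e b T r,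
      fun T hT r => ?_, fun b y hy => ?_, fun b => ?_⟩
    · by_cases hxT' : x ∈ T
      · have hT' : T.erase x ∈ S.powerset := by
          rw [mem_powerset] at hT ⊢
          exact subset_insert_iff.1 hT
        simp only [if_pos hxT']
        rw [he3 _ hT', ← card_erase_add_one hxT']
        congr 2
        omega
      · simp only [if_neg hxT']
        refine hrest T ?_ r
        rw [mem_powerset] at hT ⊢
        exact (subset_insert_iff_of_notMem hxT').1 hT
    · have hstep : ∀ T ∈ S.powerset, ∀ r, 0 < e (some b) T r →
          insert x T ∈ (insert x S).powerset ∧ ∃ r', 0 < if x ∈ insert x T then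
            e (some b) ((insert x T).erase x) (r' + 1) else
            A (some b) (insert x T) r' - e (some b) (insert x T) r' := by
        intro T hT r hr
        refine ⟨mem_powerset.2 (insert_subset_insert x (mem_powerset.1 hT)), ?_⟩
        rcases r with _ | r
        · simp [he2] at hr
        · exact ⟨r, by simpa [erase_insert (hxT T hT)] using hr⟩
      rcases mem_insert.1 hy with rfl | hy
      · obtain ⟨T, hT, hT'⟩ := exists_ne_zero_of_sum_ne_zero
          (Nat.one_le_iff_ne_zero.1 (he4 (some b) (h3 b)).1)
        obtain ⟨r, -, hr⟩ := exists_ne_zero_of_sum_ne_zero hT'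
        obtain ⟨h, h'⟩ := hstep T hT r (Nat.pos_of_ne_zero hr)
        exact ⟨_, h, mem_insert_self _ _, h'⟩
      · obtain ⟨T, hT, hyT, r, hr⟩ := h2 b y hy
        by_cases her : 0 < e (some b) T r
        · obtain ⟨h, h'⟩ := hstep T hT r her
          exact ⟨_, h, mem_insert_of_mem hyT, h'⟩
        · refine ⟨T, powerset_mono.2 (subset_insert x S) hT, hyT, r, ?_⟩
          simp only [if_neg (hxT T hT)]
          omega
    · have hW := (he4 (some b) (h3 b)).2
      rw [sum_powerset_insert hx]
      have e1 : ∑ T ∈ S.powerset, ∑ r ∈ range (u + 1), r * (if x ∈ T then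
          e (some b) (T.erase x) (r + 1) else A (some b) T r - e (some b) T r) =
          ∑ T ∈ S.powerset, ∑ r ∈ range (u + 2), r * (A (some b) T r - e (some b) T r) := by
        refine sum_congr rfl fun T hT => ?_
        have h0 := hrest T hT (u + 1)
        rw [Nat.choose_succ_self, zero_mul, sum_eq_zero_iff] at h0
        rw [sum_range_succ _ (u + 1), h0 (some b) (mem_univ _), mul_zero, add_zero]
        simp only [if_neg (hxT T hT)]
      have e2 : ∑ T ∈ S.powerset, ∑ r ∈ range (u + 1), r * (if x ∈ insert x T then
          e (some b) ((insert x T).erase x) (r + 1) else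
          A (some b) (insert x T) r - e (some b) (insert x T) r) =
          ∑ T ∈ S.powerset, ∑ r ∈ range (u + 2), (r - 1) * e (some b) T r := by
        refine sum_congr rfl fun T hT => ?_
        rw [sum_range_succ' _ (u + 1), he2, mul_zero, add_zero]
        simp [erase_insert (hxT T hT)]
      rw [e1, e2]
      refine Nat.le_of_add_le_add_left (hW.trans ?_)
      simp only [← sum_add_distrib]
      refine sum_le_sum fun T hT => sum_le_sum fun r _ => ?_
      have h := he1 (some b) T hT r
      rcases r with _ | r
      · simp
      · obtain ⟨d, hd⟩ := Nat.exists_eq_add_of_le h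
        rw [hd]
        simp
        nlinarith

/-- A multiset of sum at least `l` contains a minimal part of sum at least `l`. -/
theorem exists_cons_le_of_le_sum (l : ℕ) (hl : 0 < l) (U : Multiset ℕ) (h : l ≤ U.sum) :
    ∃ (P : Multiset ℕ) (u : ℕ), u ::ₘ P ≤ U ∧ P.sum < l ∧ l ≤ P.sum + u := by
  induction U using Multiset.induction_on with
  | empty => simp at h; omega
  | cons a U ih =>
    by_cases h' : l ≤ U.sum
    · obtain ⟨P, u, h1, h2⟩ := ih h'
      exact ⟨P, u, h1.trans (Multiset.le_cons_self _ _), h2⟩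
    · refine ⟨U, a, le_rfl, by omega, ?_⟩
      rw [Multiset.sum_cons] at h
      omega

/-- If a packing `R` of bins of size at least `l` has at least `Q` copies of each exact bin with
three parts, then a pile `U` of total size at least `l * Q` can be packed into `Q` more bins. -/
theorem exists_cut_bins (l : ℕ) (hl : 0 < l) (Q : ℕ) (R : Multiset (Multiset ℕ))
    (U : Multiset ℕ) (hR : ∀ B ∈ R, l ≤ B.sum) (hU : ∀ u ∈ U, 1 ≤ u ∧ u < l)
    (hcount : ∀ a b c, 0 < a → 0 < b → 0 < c → a + b + c = l → Q ≤ R.count {a, b, c})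
    (hsum : l * Q ≤ U.sum) :
    ∃ 𝔅 : Multiset (Multiset ℕ), 𝔅.card = R.card + Q ∧ (∀ B ∈ 𝔅, l ≤ B.sum) ∧
      𝔅.join ≤ R.join + U := by
  induction Q generalizing R U with
  | zero => exact ⟨R, by simp, hR, Multiset.le_add_right _ _⟩
  | succ Q ih =>
    rw [mul_add, mul_one] at hsum
    obtain ⟨P, u, hPU, hP1, hP2⟩ := exists_cons_le_of_le_sum l hl U (by omega)
    obtain ⟨U', rfl⟩ := Multiset.le_iff_exists_add.1 hPU
    have hu := hU u (by simp)
    simp only [Multiset.sum_add, Multiset.sum_cons] at hsum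
    obtain ⟨d, hd⟩ : ∃ d, P.sum + d = l := ⟨l - P.sum, by omega⟩
    rcases (show d ≤ u by omega).eq_or_lt with rfl | hdu
    · obtain ⟨𝔅, h1, h2, h3⟩ := ih R U' hR (fun v hv => hU v (by simp [hv]))
        (fun a b c ha hb hc h => (Nat.le_succ Q).trans (hcount a b c ha hb hc h)) (by omega)
      refine ⟨(d ::ₘ P) ::ₘ 𝔅, by simp [h1]; omega, ?_, ?_⟩
      · intro B hB
        rcases Multiset.mem_cons.1 hB with rfl | hB
        · simp only [Multiset.sum_cons]
          omega
        · exact h2 B hB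
      · rw [Multiset.join_cons]
        refine (add_le_add_right h3 _).trans_eq ?_
        abel
    · obtain ⟨v, rfl⟩ := Nat.exists_eq_add_of_lt hdu
      obtain ⟨w, hw⟩ := Nat.exists_eq_add_of_lt hu.2
      have hT : ({d, v + 1, w + 1} : Multiset ℕ) ∈ R := by
        rw [← Multiset.one_le_count_iff_mem]
        exact le_trans (by omega) (hcount d (v + 1) (w + 1) (by omega) (by omega) (by omega)
          (by omega))
      obtain ⟨R₀, rfl⟩ := Multiset.exists_cons_of_mem hT
      obtain ⟨𝔅, h1, h2, h3⟩ := ih R₀ ((v + 1) ::ₘ U') (fun B hB => hR B (by simp [hB]))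
        (by
          intro y hy
          rcases Multiset.mem_cons.1 hy with rfl | hy
          · omega
          · exact hU y (by simp [hy]))
        (by
          intro a b c ha hb hc h
          have := hcount a b c ha hb hc h
          rw [Multiset.count_cons] at this
          split_ifs at this <;> omega)
        (by rw [Multiset.sum_cons]; omega)
      refine ⟨{d + v + 1, w + 1} ::ₘ (d ::ₘ P) ::ₘ 𝔅, by simp [h1]; omega, ?_, ?_⟩
      · intro B hB
        rcases Multiset.mem_cons.1 hB with rfl | hB
        · simp
          omega
        rcases Multiset.mem_cons.1 hB with rfl | hB
        · simp only [Multiset.sum_cons]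
          omega
        · exact h2 B hB
      · simp only [Multiset.join_cons]
        refine (add_le_add_right (add_le_add_right h3 _) _).trans_eq ?_
        simp only [Multiset.insert_eq_cons, ← Multiset.singleton_add]
        abel

/-- Items of sizes at least `l / 2` can be packed in pairs. -/
theorem exists_pair_bins (l Q : ℕ) (U : Multiset ℕ) (hU : ∀ u ∈ U, l ≤ 2 * u)
    (hcard : 2 * Q ≤ U.card) :
    ∃ 𝔅 : Multiset (Multiset ℕ), 𝔅.card = Q ∧ (∀ B ∈ 𝔅, l ≤ B.sum) ∧ 𝔅.join ≤ U := by
  induction Q generalizing U with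
  | zero => exact ⟨0, by simp, by simp, by simp⟩
  | succ Q ih =>
    obtain ⟨a, ha⟩ := Multiset.card_pos_iff_exists_mem.1 (show 0 < U.card by omega)
    obtain ⟨U, rfl⟩ := Multiset.exists_cons_of_mem ha
    rw [Multiset.card_cons] at hcard
    obtain ⟨b, hb⟩ := Multiset.card_pos_iff_exists_mem.1 (show 0 < U.card by omega)
    obtain ⟨U, rfl⟩ := Multiset.exists_cons_of_mem hb
    rw [Multiset.card_cons] at hcard
    obtain ⟨𝔅, h1, h2, h3⟩ := ih U (fun u hu => hU u (by simp [hu])) (by omega)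
    refine ⟨{a, b} ::ₘ 𝔅, by simp [h1], ?_, ?_⟩
    · intro B hB
      rcases Multiset.mem_cons.1 hB with rfl | hB
      · have := hU a (by simp)
        have := hU b (by simp)
        simp
        omega
      · exact h2 B hB
    · rw [Multiset.join_cons]
      refine (add_le_add_right h3 _).trans_eq ?_
      simp

/-- The multiset of sizes of the nonempty fibres of a map, as a partition of the domain. -/
def fiberPartition {k l : ℕ} (g : Fin l → Fin k) : Nat.Partition l :=
  Nat.Partition.ofSums l (univ.val.map fun i => (univ.filter fun j => g j = i).card) (by
    have h := card_eq_sum_card_fiberwise (f := g) (s := univ) (t := univ) (by simp)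
    rw [card_fin] at h
    rw [← Finset.sum_eq_multiset_sum, ← h])

theorem count_fiberPartition {k l : ℕ} (g : Fin l → Fin k) {m : ℕ} (hm : m ≠ 0) :
    (fiberPartition g).parts.count m =
      (univ.filter fun i => (univ.filter fun j => g j = i).card = m).card := by
  rw [fiberPartition, Nat.Partition.count_ofSums_of_ne_zero _ hm, Multiset.count_map]
  simp only [eq_comm (a := m)]
  rfl

theorem card_filter_card_fiber {k l : ℕ} (i : Fin k) (m : ℕ) :
    (univ.filter fun g : Fin l → Fin k => (univ.filter fun j => g j = i).card = m).card =
      l.choose m * (k - 1) ^ (l - m) := by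
  rw [card_eq_sum_card_fiberwise (f := fun g : Fin l → Fin k => univ.filter fun j => g j = i)
    (t := powersetCard m univ) (by
      intro g hg
      simpa [mem_powersetCard] using hg)]
  rw [sum_congr rfl fun A hA => ?_, sum_const, card_powersetCard, card_fin, smul_eq_mul]
  rw [mem_powersetCard] at hA
  have : ((univ.filter fun g : Fin l → Fin k => (univ.filter fun j => g j = i).card = m).filter
      fun g => (univ.filter fun j => g j = i) = A) =
      Fintype.piFinset fun j => if j ∈ A then {i} else univ.erase i := by
    ext g
    simp only [mem_filter, mem_univ, true_and, Fintype.mem_piFinset]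
    constructor
    · rintro ⟨-, rfl⟩ j
      by_cases h : g j = i <;> simp [h]
    · intro h
      have : (univ.filter fun j => g j = i) = A := by
        ext j
        have := h j
        by_cases hj : j ∈ A <;> simpa [hj] using this
      exact ⟨by rw [this, hA.2], this⟩
  rw [this, Fintype.card_piFinset, ← prod_mul_prod_compl A]
  rw [prod_congr rfl (g := fun _ => 1) fun j hj => by simp [hj]]
  rw [prod_congr (s₁ := Aᶜ) rfl (g := fun _ => k - 1) fun j hj => by
    simp [mem_compl.1 hj]]
  simp [card_compl, hA.2]

theorem sum_count_fiberPartition {k l m : ℕ} (hm : m ≠ 0) :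
    ∑ g : Fin l → Fin k, (fiberPartition g).parts.count m =
      k * (l.choose m * (k - 1) ^ (l - m)) := by
  simp only [count_fiberPartition _ hm, card_eq_sum_ones, sum_filter]
  rw [sum_comm]
  simp only [← sum_filter, ← card_eq_sum_ones, card_filter_card_fiber]
  simp

theorem fiberPartition_parts_of_card {k l a b c : ℕ} (g : Fin l → Fin k) (e : Fin 3 ↪ Fin k)
    (ha : 0 < a) (hb : 0 < b) (hc : 0 < c) (habc : a + b + c = l)
    (h0 : (univ.filter fun j => g j = e 0).card = a)
    (h1 : (univ.filter fun j => g j = e 1).card = b)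
    (h2 : (univ.filter fun j => g j = e 2).card = c) :
    (∀ i, i = e 0 ∨ i = e 1 ∨ i = e 2 ∨ (univ.filter fun j => g j = i).card = 0) ∧
      (fiberPartition g).parts = {a, b, c} := by
  have hsum := card_eq_sum_card_fiberwise (f := g) (s := univ) (t := univ) (by simp)
  rw [card_fin, ← sum_add_sum_compl (univ.map e), sum_map, Fin.sum_univ_three, h0, h1, h2,
    habc, left_eq_add, sum_eq_zero_iff] at hsum
  have hzero : ∀ i, i = e 0 ∨ i = e 1 ∨ i = e 2 ∨ (univ.filter fun j => g j = i).card = 0 := by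
    intro i
    by_cases hi : i ∈ univ.map e
    · obtain ⟨x, -, rfl⟩ := mem_map.1 hi
      fin_cases x <;> simp
    · exact Or.inr (Or.inr (Or.inr (hsum i (mem_compl.2 hi))))
  refine ⟨hzero, ?_⟩
  have hE : (univ.filter fun i => (univ.filter fun j => g j = i).card ≠ 0) = univ.map e := by
    ext i
    simp only [mem_filter, mem_univ, true_and, mem_map]
    constructor
    · intro hi
      rcases hzero i with rfl | rfl | rfl | h
      exacts [⟨0, rfl⟩, ⟨1, rfl⟩, ⟨2, rfl⟩, absurd h hi]
    · rintro ⟨x, rfl⟩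
      fin_cases x <;> simp only [Fin.zero_eta, Fin.mk_one, Fin.reduceFinMk, h0, h1, h2] <;> omega
  have hval : (univ.filter fun i => (univ.filter fun j => g j = i).card ≠ 0).val =
      {e 0, e 1, e 2} := by
    rw [hE]
    rfl
  rw [filter_val] at hval
  rw [fiberPartition, Nat.Partition.ofSums_parts, Multiset.filter_map]
  trans Multiset.map (fun i => (univ.filter fun j => g j = i).card) {e 0, e 1, e 2}
  · rw [← hval]
    congr!
  · simp [h0, h1, h2]

theorem choose_mul_choose_le_card {k l a b c : ℕ} (e : Fin 3 ↪ Fin k) (habc : a + b + c = l) :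
    l.choose a * (l - a).choose b ≤ (univ.filter fun g : Fin l → Fin k =>
      (univ.filter fun j => g j = e 0).card = a ∧ (univ.filter fun j => g j = e 1).card = b ∧
      (univ.filter fun j => g j = e 2).card = c).card := by
  have h01 : e 0 ≠ e 1 := fun h => absurd (e.injective h) (by decide)
  have h02 : e 0 ≠ e 2 := fun h => absurd (e.injective h) (by decide)
  have h12 : e 1 ≠ e 2 := fun h => absurd (e.injective h) (by decide)
  let W : Finset (Σ _ : Finset (Fin l), Finset (Fin l)) :=
    (powersetCard a univ).sigma fun A => powersetCard b Aᶜ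
  have hW : W.card = l.choose a * (l - a).choose b := by
    rw [card_sigma, sum_congr rfl (g := fun _ => (l - a).choose b) fun A hA => ?_]
    · simp
    · rw [card_powersetCard, card_compl, (mem_powersetCard.1 hA).2, Fintype.card_fin]
  rw [← hW]
  let F : (Σ _ : Finset (Fin l), Finset (Fin l)) → Fin l → Fin k :=
    fun w j => if j ∈ w.1 then e 0 else if j ∈ w.2 then e 1 else e 2
  have hF : ∀ w ∈ W, (univ.filter fun j => F w j = e 0) = w.1 ∧
      (univ.filter fun j => F w j = e 1) = w.2 ∧
      (univ.filter fun j => F w j = e 2) = (w.1 ∪ w.2)ᶜ ∧ w.1.card = a ∧ w.2.card = b ∧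
      Disjoint w.1 w.2 := by
    rintro ⟨A, B⟩ hw
    obtain ⟨hA, hB⟩ := mem_sigma.1 hw
    rw [mem_powersetCard] at hA hB
    have hdisj : ∀ j ∈ B, j ∉ A := fun j hj => mem_compl.1 (hB.1 hj)
    refine ⟨?_, ?_, ?_, hA.2, hB.2, disjoint_right.2 hdisj⟩ <;> ext j <;>
      have := hdisj j <;> by_cases hjA : j ∈ A <;> by_cases hjB : j ∈ B <;>
      simp_all [F, h01.symm, h02.symm, h12.symm]
  refine card_le_card_of_injOn F (fun w hw => ?_) fun w hw w' hw' h => ?_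
  · obtain ⟨h0, h1, h2, h3, h4, h5⟩ := hF w hw
    simp only [coe_filter, mem_univ, true_and, Set.mem_ofPred_eq]
    rw [h0, h1, h2, card_compl, card_union_of_disjoint h5, Fintype.card_fin, h3, h4]
    exact ⟨rfl, rfl, by omega⟩
  · obtain ⟨h0, h1, -⟩ := hF w hw
    obtain ⟨h0', h1', -⟩ := hF w' hw'
    rw [h] at h0 h1
    exact Sigma.ext (h0.symm.trans h0') (heq_of_eq (h1.symm.trans h1'))

theorem descFactorial_mul_le_card_fiberPartition {k l a b c : ℕ} (ha : 0 < a) (hb : 0 < b)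
    (hc : 0 < c) (habc : a + b + c = l) (N : ℕ)
    (hN : ∀ g : Fin l → Fin k, (univ.filter fun e : Fin 3 ↪ Fin k =>
      (univ.filter fun j => g j = e 0).card = a ∧ (univ.filter fun j => g j = e 1).card = b ∧
      (univ.filter fun j => g j = e 2).card = c).card ≤ N) :
    k.descFactorial 3 * (l.choose a * (l - a).choose b) ≤
      N * (univ.filter fun g : Fin l → Fin k => (fiberPartition g).parts = {a, b, c}).card := by
  let G : (Fin l → Fin k) → (Fin 3 ↪ Fin k) → Prop := fun g e =>
    (univ.filter fun j => g j = e 0).card = a ∧ (univ.filter fun j => g j = e 1).card = b ∧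
      (univ.filter fun j => g j = e 2).card = c
  have hcard : (univ : Finset (Fin 3 ↪ Fin k)).card = k.descFactorial 3 := by
    simp [Fintype.card_embedding_eq]
  calc k.descFactorial 3 * (l.choose a * (l - a).choose b)
      = ∑ e : Fin 3 ↪ Fin k, l.choose a * (l - a).choose b := by
        rw [sum_const, hcard, smul_eq_mul]
    _ ≤ ∑ e : Fin 3 ↪ Fin k, (univ.filter fun g => G g e).card :=
        sum_le_sum fun e _ => choose_mul_choose_le_card e habc
    _ = ∑ g, (univ.filter fun e => G g e).card := by
        simp only [card_eq_sum_ones, sum_filter]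
        exact sum_comm
    _ ≤ ∑ g, if (fiberPartition g).parts = {a, b, c} then N else 0 := by
        refine sum_le_sum fun g _ => ?_
        split_ifs with h
        · exact hN g
        · refine (card_eq_zero.2 (filter_eq_empty_iff.2 fun e _ he => h ?_)).le
          exact (fiberPartition_parts_of_card g e ha hb hc habc he.1 he.2.1 he.2.2).2
    _ = _ := by
        rw [← sum_filter, sum_const, smul_eq_mul, mul_comm]

theorem card_filter_embedding_le_two {k l a b c : ℕ} (ha : 0 < a) (hab : a ≤ b) (hbc : b ≤ c)
    (hac : a < c) (habc : a + b + c = l) (g : Fin l → Fin k) :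
    (univ.filter fun e : Fin 3 ↪ Fin k =>
      (univ.filter fun j => g j = e 0).card = a ∧ (univ.filter fun j => g j = e 1).card = b ∧
      (univ.filter fun j => g j = e 2).card = c).card ≤ 2 := by
  rcases eq_empty_or_nonempty (univ.filter fun e : Fin 3 ↪ Fin k =>
      (univ.filter fun j => g j = e 0).card = a ∧ (univ.filter fun j => g j = e 1).card = b ∧
      (univ.filter fun j => g j = e 2).card = c) with h | ⟨e₀, h⟩
  · simp [h]
  obtain ⟨-, h0, h1, h2⟩ := mem_filter.1 h
  have hz := (fiberPartition_parts_of_card g e₀ ha (by omega) (by omega) habc h0 h1 h2).1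
  have hne : ∀ e : Fin 3 ↪ Fin k, e 0 ≠ e 1 ∧ e 0 ≠ e 2 ∧ e 1 ≠ e 2 := fun e =>
    ⟨fun h => absurd (e.injective h) (by decide), fun h => absurd (e.injective h) (by decide),
      fun h => absurd (e.injective h) (by decide)⟩
  generalize hf : (fun i => (univ.filter fun j => g j = i).card) = f at *
  replace hf : ∀ i, (univ.filter fun j => g j = i).card = f i := fun i => congrFun hf i
  simp only [hf] at *
  have hne0 := hne e₀
  rcases hbc.lt_or_eq with hbc | rfl
  · refine (card_le_card_of_injOn (fun e => e 0) (t := {e₀ 0, e₀ 1}) (fun e he => ?_)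
      fun e he e' he' h => ?_).trans card_le_two
    · simp only [coe_filter, mem_univ, true_and, Set.mem_ofPred_eq] at he
      have := hz (e 0)
      simp only [coe_insert, coe_singleton, Set.mem_insert_iff, Set.mem_singleton_iff]
      grind
    · simp only [coe_filter, mem_univ, true_and, Set.mem_ofPred_eq] at he he' h
      have e1 := hne e
      have e2 := hne e'
      have e3 := hz (e 0)
      have e4 := hz (e 1)
      have e5 := hz (e 2)
      have e6 := hz (e' 1)
      have e7 := hz (e' 2)
      have : e 0 = e' 0 ∧ e 1 = e' 1 ∧ e 2 = e' 2 := by grind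
      ext x
      fin_cases x <;> simp [this]
  · refine (card_le_card_of_injOn (fun e => e 1) (t := {e₀ 1, e₀ 2}) (fun e he => ?_)
      fun e he e' he' h => ?_).trans card_le_two
    · simp only [coe_filter, mem_univ, true_and, Set.mem_ofPred_eq] at he
      have := hz (e 1)
      simp only [coe_insert, coe_singleton, Set.mem_insert_iff, Set.mem_singleton_iff]
      grind
    · simp only [coe_filter, mem_univ, true_and, Set.mem_ofPred_eq] at he he' h
      have e1 := hne e
      have e2 := hne e'
      have e3 := hz (e 0)
      have e4 := hz (e 1)
      have e5 := hz (e 2)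
      have e6 := hz (e' 0)
      have e7 := hz (e' 2)
      have : e 0 = e' 0 ∧ e 1 = e' 1 ∧ e 2 = e' 2 := by grind
      ext x
      fin_cases x <;> simp [this]

theorem card_filter_embedding_le_six {k l a b c : ℕ} (ha : 0 < a) (hb : 0 < b) (hc : 0 < c)
    (habc : a + b + c = l) (g : Fin l → Fin k) :
    (univ.filter fun e : Fin 3 ↪ Fin k =>
      (univ.filter fun j => g j = e 0).card = a ∧ (univ.filter fun j => g j = e 1).card = b ∧
      (univ.filter fun j => g j = e 2).card = c).card ≤ 6 := by
  rcases eq_empty_or_nonempty (univ.filter fun e : Fin 3 ↪ Fin k =>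
      (univ.filter fun j => g j = e 0).card = a ∧ (univ.filter fun j => g j = e 1).card = b ∧
      (univ.filter fun j => g j = e 2).card = c) with h | ⟨e₀, h⟩
  · simp [h]
  obtain ⟨-, h0, h1, h2⟩ := mem_filter.1 h
  have hz := (fiberPartition_parts_of_card g e₀ ha hb hc habc h0 h1 h2).1
  have hne : ∀ e : Fin 3 ↪ Fin k, e 0 ≠ e 1 ∧ e 0 ≠ e 2 ∧ e 1 ≠ e 2 := fun e =>
    ⟨fun h => absurd (e.injective h) (by decide), fun h => absurd (e.injective h) (by decide),
      fun h => absurd (e.injective h) (by decide)⟩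
  generalize hf : (fun i => (univ.filter fun j => g j = i).card) = f at *
  replace hf : ∀ i, (univ.filter fun j => g j = i).card = f i := fun i => congrFun hf i
  simp only [hf] at *
  refine (card_le_card_of_injOn (fun e => (e 0, e 1)) (t := (univ.map e₀).offDiag) (fun e he => ?_)
    fun e he e' he' h => ?_).trans_eq (by rw [offDiag_card]; simp)
  · simp only [coe_filter, mem_univ, true_and, Set.mem_ofPred_eq] at he
    have e3 := hz (e 0)
    have e4 := hz (e 1)
    have e5 := hne e
    simp only [coe_offDiag, Set.mem_offDiag, mem_coe, mem_map, mem_univ, true_and,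
      Fin.exists_fin_succ]
    grind
  · simp only [coe_filter, mem_univ, true_and, Set.mem_ofPred_eq, Prod.mk.injEq] at he he' h
    have e1 := hne e
    have e2 := hne e'
    have e3 := hz (e 0)
    have e4 := hz (e 1)
    have e5 := hz (e 2)
    have e7 := hz (e' 2)
    have : e 0 = e' 0 ∧ e 1 = e' 1 ∧ e 2 = e' 2 := by grind
    ext x
    fin_cases x <;> simp [this]

theorem le_choose {n r : ℕ} (hr : 0 < r) (hrn : r < n) : n ≤ n.choose r := by
  induction n generalizing r with
  | zero => omega
  | succ n ih =>
    obtain ⟨r, rfl⟩ := Nat.exists_eq_add_of_lt hr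
    rw [zero_add]
    rcases (show r + 1 ≤ n by omega).eq_or_lt with rfl | h
    · simp
    · have h1 := ih (Nat.succ_pos r) h
      have h2 := Nat.choose_pos (show r ≤ n by omega)
      rw [Nat.choose_succ_succ]
      simp only [Nat.succ_eq_add_one] at *
      omega

theorem card_fiberPartition_three_parts {k l a b c : ℕ} (ha : 0 < a) (hab : a ≤ b) (hbc : b ≤ c)
    (habc : a + b + c = l) (hl : 4 ≤ l) :
    k.descFactorial 3 * (l * (l - 1)) ≤
      4 * (univ.filter fun g : Fin l → Fin k => (fiberPartition g).parts = {a, b, c}).card := by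
  have h1 : l ≤ l.choose a := le_choose ha (by omega)
  rcases (hab.trans hbc).lt_or_eq with hac | hac
  · have h := descFactorial_mul_le_card_fiberPartition (k := k) ha (by omega) (by omega) habc 2
      (card_filter_embedding_le_two ha hab hbc hac habc)
    have h2 : l - a ≤ (l - a).choose b := le_choose (by omega) (by omega)
    have h3 : l * (l - 1) ≤ 2 * (l.choose a * (l - a).choose b) := by
      calc l * (l - 1) ≤ l * (2 * (l - a)) := Nat.mul_le_mul_left _ (by omega)
        _ = 2 * (l * (l - a)) := by ring
        _ ≤ _ := by gcongr
    calc _ ≤ k.descFactorial 3 * (2 * (l.choose a * (l - a).choose b)) := Nat.mul_le_mul_left _ h3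
      _ ≤ _ := by linarith
  · have h := descFactorial_mul_le_card_fiberPartition (k := k) ha (by omega) (by omega) habc 6
      (card_filter_embedding_le_six ha (by omega) (by omega) habc)
    have h2 : l - a ≤ (l - a).choose b := le_choose (by omega) (by omega)
    have h3 : ∀ r, 2 ≤ r → r ≤ l / 2 → l.choose 2 ≤ l.choose r := by
      intro r hr
      induction r, hr using Nat.le_induction with
      | base => exact fun _ => le_rfl
      | succ r _ ih =>
        exact fun h => (ih (by omega)).trans (Nat.choose_le_succ_of_lt_half_left (by omega))
    replace h3 := h3 a (by omega) (by omega)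
    have h4 : l.choose 2 * 2 = l * (l - 1) := by
      rw [Nat.choose_two_right]
      exact Nat.div_mul_cancel (Nat.even_mul_pred_self l).two_dvd
    have h5 : 3 * (l * (l - 1)) ≤ 2 * (l.choose a * (l - a).choose b) := by
      calc 3 * (l * (l - 1)) = 2 * (l.choose 2 * 3) := by rw [← h4]; ring
        _ ≤ _ := by gcongr; omega
    have h6 := Nat.mul_le_mul_left (k.descFactorial 3) h5
    nlinarith

theorem mem_Ico_of_mem_parts {l : ℕ} {lam : Nat.Partition l}
    (hlam : lam ≠ Nat.Partition.indiscrete l) {m : ℕ} (hm : m ∈ lam.parts) : m ∈ Ico 1 l := by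
  have hm0 := lam.parts_pos hm
  rw [mem_Ico]
  refine ⟨hm0, (Nat.Partition.le_of_mem_parts hm).lt_of_ne ?_⟩
  rintro rfl
  apply hlam
  obtain ⟨P, hP⟩ := Multiset.exists_cons_of_mem hm
  have h := lam.parts_sum
  have hpos := fun i => lam.parts_pos (i := i)
  rw [hP] at h hpos
  rw [Multiset.sum_cons, Nat.add_eq_left, Multiset.sum_eq_zero_iff] at h
  have : P = 0 := Multiset.eq_zero_of_forall_notMem fun i hi => by
    have h1 := h i hi
    have h2 := hpos i (Multiset.mem_cons_of_mem hi)
    omega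
  ext1
  rw [hP, this, Nat.Partition.indiscrete_parts hm0.ne']
  rfl

theorem sum_mul_count_parts {l : ℕ} (lam : Nat.Partition l)
    (hlam : lam ≠ Nat.Partition.indiscrete l) :
    ∑ m ∈ Ico 1 l, m * lam.parts.count m = l := by
  have h := Finset.sum_multiset_count_of_subset lam.parts (Ico 1 l) fun m hm =>
    mem_Ico_of_mem_parts hlam (Multiset.mem_toFinset.1 hm)
  rw [lam.parts_sum] at h
  exact (sum_congr rfl fun m _ => by rw [smul_eq_mul, mul_comm]).trans h.symm

theorem sum_mul_sum_mul_count {l : ℕ} (y : Nat.Partition l → ℝ)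
    (hy : y (Nat.Partition.indiscrete l) = 0) :
    ∑ m ∈ Ico 1 l, (m : ℝ) * ∑ lam, y lam * lam.parts.count m = l * ∑ lam, y lam := by
  simp only [mul_sum]
  rw [sum_comm]
  refine sum_congr rfl fun lam _ => ?_
  by_cases h : lam = Nat.Partition.indiscrete l
  · simp [h, hy]
  · conv_rhs => rw [← sum_mul_count_parts lam h]
    push_cast
    rw [sum_mul]
    exact sum_congr rfl fun m _ => by ring

/-- Rounding a fractional packing by partitions loses at most `l - 2` bins. -/
theorem exists_nat_packing {l : ℕ} (hl : 2 ≤ l) (y : Nat.Partition l → ℝ) (hy0 : ∀ lam, 0 ≤ y lam)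
    (hy : y (Nat.Partition.indiscrete l) = 0) (M : ℕ) (hM : M < ∑ lam, y lam) :
    ∃ z : Nat.Partition l → ℕ, (∀ lam, ⌊y lam⌋₊ ≤ z lam) ∧ z (Nat.Partition.indiscrete l) = 0 ∧
      (∀ m ∈ Ico 1 l, (∑ lam, z lam * lam.parts.count m : ℕ) ≤ ∑ lam, y lam * lam.parts.count m) ∧
      M + 2 ≤ ∑ lam, z lam + l := by
  classical
  let φ : (Nat.Partition l → ℝ) →ₗ[ℝ] (Fin (l - 1) → ℝ) :=
    { toFun := fun d i => ∑ lam, d lam * lam.parts.count (i + 1 : ℕ)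
      map_add' := by intro f g; ext; simp [sum_add_distrib, add_mul]
      map_smul' := by intro c f; ext; simp [mul_sum, mul_assoc] }
  obtain ⟨z, hz1, hz2, hz3⟩ := exists_round_injective φ y
  have hcount : ∀ m ∈ Ico 1 l, ∑ lam, z lam * lam.parts.count m =
      ∑ lam, y lam * lam.parts.count m := by
    intro m hm
    rw [mem_Ico] at hm
    have := congrFun hz1 ⟨m - 1, by omega⟩
    simp only [φ, LinearMap.coe_mk, AddHom.coe_mk, Nat.sub_add_cancel hm.1] at this
    exact this
  have hz0 : ∀ lam, 0 ≤ z lam := fun lam =>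
    le_trans (by exact_mod_cast Int.floor_nonneg.2 (hy0 lam)) (hz2 lam).1
  have hzi : z (Nat.Partition.indiscrete l) = 0 := by
    have := hz2 (Nat.Partition.indiscrete l)
    rw [hy, Int.floor_zero, Int.ceil_zero, Int.cast_zero] at this
    exact le_antisymm this.2 this.1
  have hsum : ∑ lam, z lam = ∑ lam, y lam := by
    have h1 := sum_mul_sum_mul_count z hzi
    have h2 := sum_mul_sum_mul_count y hy
    rw [sum_congr rfl fun m hm => by rw [hcount m hm], h2] at h1
    have : (l : ℝ) ≠ 0 := by positivity
    exact (mul_left_cancel₀ this h1).symm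
  let F : Finset (Nat.Partition l) := univ.filter fun lam => ¬ ∃ a : ℤ, z lam = a
  let ψ : (F → ℝ) →ₗ[ℝ] (Nat.Partition l → ℝ) :=
    { toFun := fun f p => if h : p ∈ F then f ⟨p, h⟩ else 0
      map_add' := by intro f g; ext p; by_cases h : p ∈ F <;> simp [h]
      map_smul' := by intro c f; ext p; by_cases h : p ∈ F <;> simp [h] }
  have hinj : Function.Injective (φ ∘ₗ ψ) := by
    rw [← LinearMap.ker_eq_bot, LinearMap.ker_eq_bot']
    intro f hf
    have hψ : ψ f = 0 := by
      apply hz3 _ hf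
      intro p hp
      have : p ∉ F := by simpa [F] using hp
      simp [ψ, this]
    ext p
    have := congrFun hψ p.1
    simpa [ψ, p.2] using this
  have hF : F.card ≤ l - 1 := by
    have := LinearMap.finrank_le_finrank_of_injective hinj
    simpa [Module.finrank_fintype_fun_eq_card] using this
  refine ⟨fun lam => ⌊z lam⌋₊, fun lam => ?_, by simp [hzi], fun m hm => ?_, ?_⟩
  · refine Nat.le_floor ?_
    rw [natCast_floor_eq_intCast_floor (hy0 lam)]
    exact (hz2 lam).1
  · rw [← hcount m hm]
    push_cast
    exact sum_le_sum fun lam _ => mul_le_mul_of_nonneg_right (Nat.floor_le (hz0 lam))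
      (Nat.cast_nonneg _)
  · change M + 2 ≤ ∑ lam, ⌊z lam⌋₊ + l
    have h1 : ∑ lam, z lam ≤ ∑ lam, ((⌊z lam⌋₊ : ℝ) + if lam ∈ F then 1 else 0) := by
      refine sum_le_sum fun lam _ => ?_
      split_ifs with h
      · exact (Nat.lt_floor_add_one _).le
      · have h' : ∃ a : ℤ, z lam = a := by simpa [F] using h
        obtain ⟨a, ha⟩ := h'
        rw [natCast_floor_eq_intCast_floor (hz0 lam), ha]
        simp
    rw [sum_add_distrib, sum_ite_mem, univ_inter, sum_const, nsmul_one, hsum] at h1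
    have h2 : (M : ℝ) < ∑ lam, (⌊z lam⌋₊ : ℝ) + F.card := hM.trans_le h1
    have h3 : M < ∑ lam, ⌊z lam⌋₊ + F.card := by exact_mod_cast h2
    omega

/-- The number of three-part fibre patterns, for parts in any order. -/
theorem descFactorial_mul_le_card_three_parts {k l a b c : ℕ} (ha : 0 < a) (hb : 0 < b)
    (hc : 0 < c) (habc : a + b + c = l) (hl : 4 ≤ l) :
    k.descFactorial 3 * (l * (l - 1)) ≤
      4 * (univ.filter fun g : Fin l → Fin k => (fiberPartition g).parts = {a, b, c}).card := by
  have h1 : ∀ x y z : ℕ, ({x, y, z} : Multiset ℕ) = {y, x, z} := fun x y z =>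
    Multiset.cons_swap x y {z}
  have h2 : ∀ x y z : ℕ, ({x, y, z} : Multiset ℕ) = {x, z, y} := fun x y z =>
    congrArg (x ::ₘ ·) (Multiset.cons_swap y z 0)
  rcases le_total a b with hab | hab <;> rcases le_total b c with hbc | hbc <;>
    rcases le_total a c with hac | hac
  · exact card_fiberPartition_three_parts ha hab hbc habc hl
  · exact card_fiberPartition_three_parts ha hab hbc habc hl
  · rw [h2 a b c]
    exact card_fiberPartition_three_parts ha hac hbc (by omega) hl
  · rw [h2 a b c, h1 a c b]
    exact card_fiberPartition_three_parts hc hac hab (by omega) hl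
  · rw [h1 a b c]
    exact card_fiberPartition_three_parts hb hab hac (by omega) hl
  · rw [h1 a b c, h2 b a c]
    exact card_fiberPartition_three_parts hb hbc hac (by omega) hl
  · rw [h1 a b c, h2 b a c, h1 b c a]
    exact card_fiberPartition_three_parts hc hbc hab (by omega) hl
  · rw [h1 a b c, h2 b a c, h1 b c a]
    exact card_fiberPartition_three_parts hc hbc hab (by omega) hl

/-- The fractional packing giving each partition a weight proportional to the number of maps
`Fin l → Fin k` with that fibre pattern, the one-part partition excepted. -/
noncomputable def fiberWeight (k l : ℕ) (s : ℝ) (lam : Nat.Partition l) : ℝ :=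
  if lam = Nat.Partition.indiscrete l then 0 else
    s / k * (univ.filter fun g : Fin l → Fin k => fiberPartition g = lam).card

theorem sum_fiberWeight_mul_count {k l : ℕ} (hk : k ≠ 0) (s : ℝ) {m : ℕ} (hm : m ∈ Ico 1 l) :
    ∑ lam, fiberWeight k l s lam * lam.parts.count m =
      s * (l.choose m * ((k - 1) ^ (l - m) : ℕ)) := by
  rw [mem_Ico] at hm
  have h1 : ∀ lam : Nat.Partition l, fiberWeight k l s lam * lam.parts.count m =
      s / k * ∑ g : Fin l → Fin k with fiberPartition g = lam,
        ((fiberPartition g).parts.count m : ℝ) := by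
    intro lam
    rw [sum_congr rfl fun g hg => by rw [(mem_filter.1 hg).2], sum_const, nsmul_eq_mul,
      fiberWeight]
    split_ifs with h
    · have : (lam.parts.count m : ℝ) = 0 := by
        rw [h, Nat.Partition.indiscrete_parts (by omega), Nat.cast_eq_zero,
          Multiset.count_eq_zero, Multiset.mem_singleton]
        omega
      simp [this]
    · ring
  simp only [h1]
  rw [← mul_sum, sum_fiberwise, ← Nat.cast_sum, sum_count_fiberPartition (by omega)]
  have : (k : ℝ) ≠ 0 := by exact_mod_cast hk
  push_cast
  field_simp

theorem le_sum_fiberWeight {k l : ℕ} (hk : k ≠ 0) (hl : 0 < l) {s : ℝ} (hs : 0 ≤ s) :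
    ((k : ℝ) ^ (l - 1) - 1) * s ≤ ∑ lam, fiberWeight k l s lam := by
  have hk' : (0 : ℝ) < k := by positivity
  have h1 : ∀ lam : Nat.Partition l, s / k * ∑ g : Fin l → Fin k with fiberPartition g = lam,
      (1 - ((fiberPartition g).parts.count l : ℝ)) ≤ fiberWeight k l s lam := by
    intro lam
    rw [sum_congr rfl fun g hg => by rw [(mem_filter.1 hg).2], sum_const, nsmul_eq_mul,
      fiberWeight]
    split_ifs with h
    · rw [h, Nat.Partition.indiscrete_parts hl.ne']
      simp
    · refine mul_le_mul_of_nonneg_left ?_ (by positivity)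
      refine mul_le_of_le_one_right (Nat.cast_nonneg _) ?_
      simp
  refine le_trans ?_ (sum_le_sum fun lam _ => h1 lam)
  rw [← mul_sum, sum_fiberwise, sum_sub_distrib, ← Nat.cast_sum,
    sum_count_fiberPartition hl.ne']
  obtain ⟨l, rfl⟩ := Nat.exists_eq_add_of_lt hl
  simp only [zero_add, Nat.add_sub_cancel, Nat.choose_self, Nat.sub_self, pow_zero, mul_one,
    sum_const, card_univ, Fintype.card_pi, Fintype.card_fin, prod_const, nsmul_eq_mul]
  push_cast
  rw [pow_succ]
  apply le_of_eq
  field_simp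

theorem le_fiberWeight_of_three_parts {k l a b d : ℕ} (hk : 3 ≤ k) {s : ℝ} (hs : 0 ≤ s)
    (hl : 4 ≤ l) (lam : Nat.Partition l) (hlam : lam.parts = {a, b, d}) :
    s * (k - 1) * (k - 2) * (l * (l - 1)) ≤ 4 * fiberWeight k l s lam := by
  have hne : lam ≠ Nat.Partition.indiscrete l := by
    intro h
    have := congrArg Multiset.card hlam
    rw [h, Nat.Partition.indiscrete_parts (by omega)] at this
    simp at this
  have hpos := fun i => lam.parts_pos (i := i)
  have hsum := lam.parts_sum
  simp only [hlam, Multiset.insert_eq_cons, Multiset.sum_cons, Multiset.sum_singleton] at hpos hsum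
  have h1 := descFactorial_mul_le_card_three_parts (k := k) (hpos a (by simp)) (hpos b (by simp))
    (hpos d (by simp)) (by omega) hl
  simp only [← hlam, ← Nat.Partition.ext_iff] at h1
  have h2 : ((k.descFactorial 3 * (l * (l - 1)) : ℕ) : ℝ) =
      (k : ℝ) * (k - 1) * (k - 2) * (l * (l - 1)) := by
    simp only [Nat.descFactorial_succ, Nat.descFactorial_zero, Nat.sub_zero]
    push_cast [Nat.cast_sub (show 1 ≤ k by omega), Nat.cast_sub (show 2 ≤ k by omega),
      Nat.cast_sub (show 1 ≤ l by omega)]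
    ring
  have h3 : (k : ℝ) * (k - 1) * (k - 2) * (l * (l - 1)) ≤
      4 * ((univ.filter fun g : Fin l → Fin k => fiberPartition g = lam).card : ℝ) := by
    rw [← h2]
    exact_mod_cast h1
  rw [fiberWeight, if_neg hne]
  have h4 := mul_le_mul_of_nonneg_left h3 (show 0 ≤ s / k by positivity)
  have hk0 : (k : ℝ) ≠ 0 := by
    have : k ≠ 0 := by omega
    exact_mod_cast this
  have h5 : s / k * ((k : ℝ) * (k - 1) * (k - 2) * (l * (l - 1))) =
      s * (k - 1) * (k - 2) * (l * (l - 1)) := by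
    field_simp
  linarith

theorem two_mul_le_of_small_weight {l u w : ℝ} (hl : 4 ≤ l) (hu : u ≤ w)
    (hw : w * (l * (l - 1)) < 4 * (l - 3)) :
    2 * (l - 3) ≤ (l - u * l) + (l * (l - 1) / 2 - l * (l - 1) / 2 * (u + w)) := by
  have h1 := mul_le_mul_of_nonneg_right hu (show 0 ≤ l * (l + 1) / 2 by positivity)
  have h2 := mul_le_mul_of_nonneg_right hw.le (show 0 ≤ l by linarith)
  have h3 : 0 ≤ l * (l - 6) ^ 2 := mul_nonneg (by linarith) (sq_nonneg _)
  have h4 : 0 ≤ (l - 1) * (l * (l + 1) / 2 - w * l ^ 2 - 2 * (l - 3)) := by linarith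
  have h5 := nonneg_of_mul_nonneg_right h4 (show 0 < l - 1 by linarith)
  linarith

/-- The items available: `l.choose m * c m` items of each size `m` with `1 ≤ m < l`. -/
def items (l : ℕ) (c : ℕ → ℕ) : Multiset ℕ :=
  ∑ m ∈ Ico 1 l, Multiset.replicate (l.choose m * c m) m

theorem count_items (l : ℕ) (c : ℕ → ℕ) (m : ℕ) :
    (items l c).count m = if m ∈ Ico 1 l then l.choose m * c m else 0 := by
  rw [items, Multiset.count_sum']
  simp only [Multiset.count_replicate]
  exact sum_ite_eq' _ _ _

theorem sum_items (l : ℕ) (c : ℕ → ℕ) :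
    (items l c).sum = ∑ m ∈ Ico 1 l, m * (l.choose m * c m) := by
  rw [items, Multiset.sum_sum]
  exact sum_congr rfl fun m _ => by rw [Multiset.sum_replicate, smul_eq_mul, mul_comm]

theorem exists_items_packing {k l M : ℕ} (hk : 3 ≤ k) (hl : 2 ≤ l) {s : ℝ} (hs : 0 < s)
    (c : ℕ → ℕ) (hc : ∀ m ∈ Ico 1 l, s * ((k - 1) ^ (l - m) : ℕ) ≤ c m)
    (hM : M < ((k : ℝ) ^ (l - 1) - 1) * s) :
    ∃ 𝔅 : Multiset (Multiset ℕ), M ≤ 𝔅.card + 1 ∧ (∀ B ∈ 𝔅, l ≤ B.sum) ∧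
      𝔅.join ≤ items l c := by
  have hky : ∀ lam, 0 ≤ fiberWeight k l s lam := by
    intro lam
    rw [fiberWeight]
    split_ifs <;> positivity
  have hM' := hM.trans_le (le_sum_fiberWeight (show k ≠ 0 by omega) (show 0 < l by omega) hs.le)
  obtain ⟨z, hz1, hz2, hz3, hz4⟩ := exists_nat_packing hl (fiberWeight k l s) hky
    (by simp [fiberWeight]) M hM'
  have hz3' : ∀ m ∈ Ico 1 l, ((∑ lam, z lam * lam.parts.count m : ℕ) : ℝ) ≤
      s * (l.choose m * ((k - 1) ^ (l - m) : ℕ)) := fun m hm =>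
    (hz3 m hm).trans_eq (sum_fiberWeight_mul_count (by omega) s hm)
  let R : Multiset (Multiset ℕ) := ∑ lam, Multiset.replicate (z lam) lam.parts
  have hRcard : R.card = ∑ lam, z lam := by simp [R]
  have hRsum : ∀ B ∈ R, B.sum = l := by
    intro B hB
    obtain ⟨lam, -, h⟩ := Multiset.mem_sum.1 hB
    rw [Multiset.eq_of_mem_replicate h, lam.parts_sum]
  have hRcount : ∀ m, R.join.count m = ∑ lam, z lam * lam.parts.count m := by
    intro m
    simp only [R, Multiset.join, Multiset.sum_sum, Multiset.count_sum', Multiset.sum_replicate,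
      Multiset.count_nsmul]
  have hRle : R.join ≤ items l c := by
    rw [Multiset.le_iff_count]
    intro m
    rw [hRcount, count_items]
    split_ifs with hm
    · have h1 := hz3' m hm
      have h2 := mul_le_mul_of_nonneg_left (hc m hm) (Nat.cast_nonneg (α := ℝ) (l.choose m))
      have h3 : ((∑ lam, z lam * lam.parts.count m : ℕ) : ℝ) ≤ ((l.choose m * c m : ℕ) : ℝ) := by
        rw [Nat.cast_mul]
        linarith
      exact_mod_cast h3
    · refine (sum_eq_zero fun lam _ => ?_).le
      by_cases h : lam = Nat.Partition.indiscrete l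
      · rw [h, hz2, zero_mul]
      · rw [Multiset.count_eq_zero.2 fun h' => hm (mem_Ico_of_mem_parts h h'), mul_zero]
  by_cases hQ : M ≤ ∑ lam, z lam + 1
  · exact ⟨R, by rwa [hRcard], fun B hB => (hRsum B hB).ge, hRle⟩
  obtain ⟨Q, hQ'⟩ : ∃ Q, M = ∑ lam, z lam + Q + 1 := ⟨M - 1 - ∑ lam, z lam, by omega⟩
  have hl4 : 4 ≤ l := by omega
  have hQl : Q + 3 ≤ l := by omega
  have hkr : (3 : ℝ) ≤ k := by exact_mod_cast hk
  have hlr : (4 : ℝ) ≤ l := by exact_mod_cast hl4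
  have hQr : (Q : ℝ) ≤ l - 3 := by
    have : ((Q + 3 : ℕ) : ℝ) ≤ l := by exact_mod_cast hQl
    push_cast at this
    linarith
  obtain ⟨U, hU⟩ := Multiset.le_iff_exists_add.1 hRle
  have hUcount : ∀ m, (items l c).count m =
      ∑ lam, z lam * lam.parts.count m + U.count m := by
    intro m
    rw [hU, Multiset.count_add, hRcount]
  rw [hU]
  by_cases hw : 4 * ((l : ℝ) - 3) ≤ s * (k - 1) * (k - 2) * (l * (l - 1))
  · obtain ⟨𝔅, h1, h2, h3⟩ := exists_cut_bins l (by omega) Q R U (fun B hB => (hRsum B hB).ge)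
      (fun u hu => by
        have : u ∈ items l c := by rw [hU]; exact Multiset.mem_add.2 (Or.inr hu)
        rw [← Multiset.count_ne_zero, count_items] at this
        split_ifs at this with h
        · exact mem_Ico.1 h
        · exact absurd rfl this)
      (fun a b d ha hb hd h => by
        let lam : Nat.Partition l := ⟨{a, b, d}, by simp; omega, by simp; omega⟩
        have h1 : z lam ≤ R.count {a, b, d} := by
          simp only [R, Multiset.count_sum']
          refine le_trans ?_ (single_le_sum (fun _ _ => Nat.zero_le _) (mem_univ lam))
          rw [show ({a, b, d} : Multiset ℕ) = lam.parts from rfl, Multiset.count_replicate_self]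
        refine le_trans ?_ ((hz1 lam).trans h1)
        refine Nat.le_floor (hQr.trans ?_)
        have h2 := le_fiberWeight_of_three_parts hk hs.le hl4 lam rfl
        linarith)
      (by
        have h1 := congrArg Multiset.sum hU
        rw [Multiset.sum_add, sum_items] at h1
        have h2 : R.join.sum = l * ∑ lam, z lam := by
          rw [Multiset.sum_join, Multiset.map_congr rfl hRsum, Multiset.map_const',
            Multiset.sum_replicate, hRcard, smul_eq_mul, mul_comm]
        have h3 := sum_mul_sum_mul_count (fiberWeight k l s) (by simp [fiberWeight])
        have h4 : (l : ℝ) * M ≤ ((∑ m ∈ Ico 1 l, m * (l.choose m * c m) : ℕ) : ℝ) := by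
          refine (mul_le_mul_of_nonneg_left hM'.le (Nat.cast_nonneg l)).trans ?_
          rw [← h3, Nat.cast_sum]
          refine sum_le_sum fun m hm => ?_
          rw [sum_fiberWeight_mul_count (by omega) s hm, Nat.cast_mul]
          refine mul_le_mul_of_nonneg_left ?_ (Nat.cast_nonneg m)
          have h2 := mul_le_mul_of_nonneg_left (hc m hm) (Nat.cast_nonneg (α := ℝ) (l.choose m))
          rw [Nat.cast_mul (l.choose m)]
          linarith
        have h5 : l * M ≤ ∑ m ∈ Ico 1 l, m * (l.choose m * c m) := by exact_mod_cast h4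
        rw [h1, h2, hQ'] at h5
        nlinarith)
    exact ⟨𝔅, by omega, h2, h3⟩
  · have hc1 : ∀ m ∈ Ico 1 l, (l.choose m : ℝ) - s * (l.choose m * ((k - 1) ^ (l - m) : ℕ)) ≤
        U.count m := by
      intro m hm
      have h1 := hUcount m
      have h2 := hz3' m hm
      rw [count_items, if_pos hm] at h1
      have h3 : (0 : ℝ) < c m := lt_of_lt_of_le (mul_pos hs (by
        have : 0 < (k - 1) ^ (l - m) := pow_pos (by omega) _
        exact_mod_cast this)) (hc m hm)
      have h4 : 1 ≤ c m := by exact_mod_cast h3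
      have h5 : l.choose m ≤ l.choose m * c m := Nat.le_mul_of_pos_right _ h4
      rw [h1] at h5
      have h6 : (l.choose m : ℝ) ≤
          ((∑ lam, z lam * lam.parts.count m : ℕ) : ℝ) + U.count m := by exact_mod_cast h5
      linarith
    let P := Multiset.replicate (U.count (l - 1)) (l - 1) +
      Multiset.replicate (U.count (l - 2)) (l - 2)
    have hPU : P ≤ U := by
      rw [Multiset.le_iff_count]
      intro m
      simp only [P, Multiset.count_add, Multiset.count_replicate]
      split_ifs with h1 h2 h2
      · omega
      · simp [h1]
      · simp [h2]
      · simp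
    obtain ⟨𝔅, h1, h2, h3⟩ := exists_pair_bins l Q P
      (fun u hu => by
        rcases Multiset.mem_add.1 hu with h | h <;> have := Multiset.eq_of_mem_replicate h <;>
          omega)
      (by
        have h1 := hc1 (l - 1) (by rw [mem_Ico]; omega)
        have h2 := hc1 (l - 2) (by rw [mem_Ico]; omega)
        rw [Nat.choose_symm (show 1 ≤ l by omega), Nat.choose_one_right,
          Nat.sub_sub_self (by omega),
          pow_one, Nat.cast_sub (by omega), Nat.cast_one] at h1
        rw [Nat.choose_symm hl, Nat.sub_sub_self hl, Nat.cast_pow, Nat.cast_sub (by omega),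
          Nat.cast_one, Nat.cast_choose_two] at h2
        have h3 : (2 * Q : ℝ) ≤ ((U.count (l - 1) + U.count (l - 2) : ℕ) : ℝ) := by
          push_cast
          push Not at hw
          have h4 : s * ((k : ℝ) - 1) ≤ s * (k - 1) * (k - 2) :=
            le_mul_of_one_le_right (mul_nonneg hs.le (by linarith)) (by linarith)
          have h5 := two_mul_le_of_small_weight hlr h4 hw
          linarith
        have h4 : 2 * Q ≤ U.count (l - 1) + U.count (l - 2) := by exact_mod_cast h3
        simpa [P] using h4)
    refine ⟨R + 𝔅, by rw [Multiset.card_add]; omega, ?_, ?_⟩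
    · intro B hB
      rcases Multiset.mem_add.1 hB with h | h
      · exact (hRsum B h).ge
      · exact h2 B h
    · rw [Multiset.join_add]
      exact add_le_add_right (h3.trans hPU) _

theorem exists_cover_of_packing {α : Type*} [Fintype α] [DecidableEq α] (c : ℕ → ℕ)
    (𝔅 : Multiset (Multiset ℕ)) (hbin : ∀ B ∈ 𝔅, Fintype.card α ≤ B.sum)
    (hcap : ∀ m, 𝔅.join.count m ≤ (Fintype.card α).choose m * c m) :
    ∃ f : Finset α → Finset (Fin 𝔅.card), (∀ Y, (f Y).card ≤ c Y.card) ∧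
      ∀ x b, ∃ Y, x ∈ Y ∧ b ∈ f Y := by
  obtain ⟨L, rfl⟩ : ∃ L : List (Multiset ℕ), (L : Multiset (Multiset ℕ)) = 𝔅 := Quot.exists_rep 𝔅
  rw [Multiset.coe_card]
  refine exists_cover_of_bins L.length c (fun b m => (L.get b).count m) (fun m => ?_) fun b => ?_
  · refine le_trans (le_of_eq ?_) (hcap m)
    rw [Multiset.join, Multiset.sum_coe, ← Multiset.coe_countAddMonoidHom, map_list_sum,
      ← List.sum_ofFn]
    congr 1
    apply List.ext_get <;> simp
  · refine (hbin _ (L.get_mem b)).trans ?_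
    rw [sum_multiset_count_of_subset (L.get b) (range (Fintype.card α + 1))]
    · exact (sum_congr rfl fun m _ => by rw [smul_eq_mul, mul_comm]).le
    · intro m hm
      by_contra h
      have h1 := hcap m
      rw [Nat.choose_eq_zero_of_lt (by simpa using h), zero_mul, Nat.le_zero,
        Multiset.count_eq_zero, Multiset.mem_join] at h1
      exact h1 ⟨L.get b, L.get_mem b, Multiset.mem_toFinset.1 hm⟩

theorem exists_cover_of_three_le {α : Type*} [Fintype α] [DecidableEq α] {k M : ℕ} (hk : 3 ≤ k)
    (hl : 2 ≤ Fintype.card α) {s : ℝ} (hs : 0 < s) (c : ℕ → ℕ)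
    (hc : ∀ m ≤ Fintype.card α, s * ((k - 1) ^ (Fintype.card α - m) : ℕ) ≤ c m)
    (hM : M < ((k : ℝ) ^ (Fintype.card α - 1) - 1) * s) :
    ∃ f : Finset α → Finset (Fin M), (∀ Y, (f Y).card ≤ c Y.card) ∧
      ∀ x b, ∃ Y, x ∈ Y ∧ b ∈ f Y := by
  obtain ⟨𝔅, h1, h2, h3⟩ := exists_items_packing hk hl hs c
    (fun m hm => hc m (mem_Ico.1 hm).2.le) hM
  obtain ⟨f, hf1, hf2⟩ := exists_cover_of_packing (α := α) c ({Fintype.card α} ::ₘ 𝔅)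
    (fun B hB => by
      rcases Multiset.mem_cons.1 hB with rfl | h
      · simp
      · exact h2 B h)
    (fun m => by
      rw [Multiset.join_cons, Multiset.count_add, Multiset.count_singleton]
      have h4 := Multiset.le_iff_count.1 h3 m
      rw [count_items] at h4
      simp only [mem_Ico] at h4
      split_ifs with h
      · have h5 : (0 : ℝ) < c (Fintype.card α) :=
          lt_of_lt_of_le (by simpa using hs) (hc _ le_rfl)
        have h6 : 0 < c (Fintype.card α) := by exact_mod_cast h5
        rw [if_neg (by omega)] at h4
        rw [h, Nat.choose_self]
        rw [h] at h4
        omega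
      · split_ifs at h4 <;> omega)
  have hM' : M ≤ ({Fintype.card α} ::ₘ 𝔅).card := by rwa [Multiset.card_cons]
  refine ⟨fun Y => univ.filter fun b => Fin.castLE hM' b ∈ f Y, fun Y => ?_, fun x b => ?_⟩
  · refine le_trans (card_le_card_of_injOn (Fin.castLE hM') (fun b hb => ?_)
      (Fin.castLE_injective hM').injOn) (hf1 Y)
    simpa using hb
  · obtain ⟨Y, hY⟩ := hf2 x (Fin.castLE hM' b)
    exact ⟨Y, by simpa using hY⟩

/-- When all subsets have the same capacity, each colour can be given to a set and to its
complement. -/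
theorem exists_cover_of_const {α : Type*} [Fintype α] [DecidableEq α] {M c : ℕ} (x₀ : α)
    (hM : M ≤ 2 ^ (Fintype.card α - 1) * c) :
    ∃ f : Finset α → Finset (Fin M), (∀ Y, (f Y).card ≤ c) ∧ ∀ x b, ∃ Y, x ∈ Y ∧ b ∈ f Y := by
  obtain ⟨P⟩ : Nonempty (Fin M ↪ (univ.erase x₀).powerset × Fin c) :=
    Function.Embedding.nonempty_of_card_le (by
      rwa [Fintype.card_prod, Fintype.card_coe, card_powerset, card_erase_of_mem (mem_univ _),
        card_univ, Fintype.card_fin, Fintype.card_fin])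
  refine ⟨fun Y => univ.filter fun b => ((P b).1 : Finset α) = Y ∨ ((P b).1 : Finset α) = Yᶜ,
    fun Y => ?_, fun x b => ?_⟩
  · have hx : ∀ b, x₀ ∉ ((P b).1 : Finset α) := fun b h =>
      absurd (mem_powerset.1 (P b).1.2 h) (notMem_erase _ _)
    have hP : ∀ b, ((P b).1 : Finset α) = Y ∨ ((P b).1 : Finset α) = Yᶜ →
        ((P b).1 : Finset α) = if x₀ ∈ Y then Yᶜ else Y := by
      intro b hb
      have h := hx b
      split_ifs with h' <;> rcases hb with hb | hb <;> simp_all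
    refine (card_le_card_of_injOn (t := univ) (fun b => (P b).2) (by simp) ?_).trans (by simp)
    intro b hb b' hb' h
    simp only [coe_filter, mem_univ, true_and, Set.mem_ofPred_eq] at hb hb'
    exact P.injective (Prod.ext (Subtype.ext ((hP b hb).trans (hP b' hb').symm)) h)
  · by_cases h : x ∈ ((P b).1 : Finset α)
    · exact ⟨_, h, by simp⟩
    · exact ⟨_, mem_compl.2 h, by simp⟩

open Filter Topology in
theorem eventually_ceil_le_ceil {x : ℝ} (hx : 0 < x) :
    ∀ᶠ η in 𝓝[>] (0 : ℝ), ⌈x⌉₊ ≤ ⌈x * (1 - η)⌉₊ := by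
  have h1 : Tendsto (fun η : ℝ => x * (1 - η)) (𝓝[>] 0) (𝓝 x) := by
    have : Continuous fun η : ℝ => x * (1 - η) := by fun_prop
    simpa using (this.tendsto 0).mono_left nhdsWithin_le_nhds
  have h2 : ((⌈x⌉₊ - 1 : ℕ) : ℝ) < x := by
    rw [← Nat.lt_ceil]
    have := Nat.ceil_pos.2 hx
    omega
  filter_upwards [h1.eventually (lt_mem_nhds h2)] with η hη
  rw [← Nat.lt_ceil] at hη
  omega

/-- For `p = 1/k`, there exist `η > 0` and an assignment `f` of colour sets (from the palette
`{1, …, ⌊(p/2 - p^l/2 - ε)n⌋}`) to the subsets of an `l`-set `X`, with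
`|f(X')| ≤ ⌈p^{|X'|}(1-p)^{l-|X'|}(1-η)n/2⌉`, such that for every `x ∈ X` the union of
`f(X')` over subsets `X'` containing `x` is the whole palette. -/
theorem stmt_19 {α : Type*} [Fintype α] [DecidableEq α] (k l n : ℕ) (hk : 1 ≤ k)
    (hl : Fintype.card α = l) (hl1 : 1 ≤ l) (hn : 0 < n) (p ε : ℝ) (hp : p = 1 / k)
    (hε : 0 < ε) :
    ∃ (η : ℝ) (f : Finset α → Finset ℕ), 0 < η ∧
      (∀ X' : Finset α, f X' ⊆ Finset.Icc 1 ⌊(p / 2 - p ^ l / 2 - ε) * n⌋₊) ∧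
      (∀ X' : Finset α,
        (f X').card ≤ ⌈p ^ X'.card * (1 - p) ^ (l - X'.card) * (1 - η) * n / 2⌉₊) ∧
      ∀ x : α, (Finset.univ.filter (fun X' : Finset α => x ∈ X')).biUnion f =
        Finset.Icc 1 ⌊(p / 2 - p ^ l / 2 - ε) * n⌋₊ := by
  have hnr : (0 : ℝ) < n := by exact_mod_cast hn
  generalize hMdef : ⌊(p / 2 - p ^ l / 2 - ε) * n⌋₊ = M
  rcases Nat.eq_zero_or_pos M with rfl | hM0
  · exact ⟨1, fun _ => ∅, one_pos, by simp, by simp, fun x => by ext; simp⟩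
  have hM : (M : ℝ) < (p / 2 - p ^ l / 2) * n := by
    have h1 : (M : ℝ) ≤ (p / 2 - p ^ l / 2 - ε) * n :=
      hMdef ▸ Nat.floor_le (Nat.pos_of_floor_pos (hMdef ▸ hM0)).le
    nlinarith
  have hpos : 0 < (p / 2 - p ^ l / 2) * n := lt_of_le_of_lt (Nat.cast_nonneg M) hM
  have hk2 : 2 ≤ k := by
    by_contra h
    obtain rfl : k = 1 := by omega
    simp [hp] at hpos
  have hl2 : 2 ≤ l := by
    by_contra h
    obtain rfl : l = 1 := by omega
    simp at hpos
  have hk0 : (0 : ℝ) < k := by positivity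
  obtain ⟨s, hsdef⟩ : ∃ s : ℝ, s = n / (2 * k ^ l) := ⟨_, rfl⟩
  have hs : 0 < s := hsdef ▸ by positivity
  have hMs : (M : ℝ) < ((k : ℝ) ^ (l - 1) - 1) * s := by
    refine hM.trans_eq ?_
    obtain ⟨t, rfl⟩ := Nat.exists_eq_add_of_le' hl1
    rw [hsdef, hp, Nat.add_sub_cancel, div_pow, one_pow, pow_succ]
    field_simp
  have hq : ∀ m ≤ l, ∀ η : ℝ, p ^ m * (1 - p) ^ (l - m) * (1 - η) * n / 2 =
      s * ((k - 1) ^ (l - m) : ℕ) * (1 - η) := by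
    intro m hm η
    obtain ⟨t, rfl⟩ := Nat.exists_eq_add_of_le hm
    have h1 : 1 - p = (k - 1) / k := by
      rw [hp]
      field_simp
    rw [h1, hp, hsdef, Nat.add_sub_cancel_left, Nat.cast_pow, Nat.cast_sub hk, Nat.cast_one,
      div_pow, div_pow, one_pow, pow_add]
    field_simp
  have hpow : ∀ m, (0 : ℝ) < s * ((k - 1) ^ (l - m) : ℕ) := by
    intro m
    have : 0 < (k - 1) ^ (l - m) := pow_pos (by omega) _
    exact mul_pos hs (by exact_mod_cast this)
  obtain ⟨f, hf1, hf2⟩ : ∃ f : Finset α → Finset (Fin M),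
      (∀ Y, (f Y).card ≤ ⌈s * ((k - 1) ^ (l - Y.card) : ℕ)⌉₊) ∧
      ∀ x b, ∃ Y, x ∈ Y ∧ b ∈ f Y := by
    subst hl
    rcases hk2.eq_or_lt with rfl | hk3
    · obtain ⟨x₀⟩ := Fintype.card_pos_iff.1 hl1
      have h1 : M ≤ 2 ^ (Fintype.card α - 1) * ⌈s⌉₊ := by
        have h2 : (M : ℝ) ≤ ((2 ^ (Fintype.card α - 1) * ⌈s⌉₊ : ℕ) : ℝ) := by
          push_cast at hMs ⊢
          have h3 := mul_le_mul_of_nonneg_left (Nat.le_ceil s)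
            (show (0 : ℝ) ≤ 2 ^ (Fintype.card α - 1) by positivity)
          linarith
        exact_mod_cast h2
      simpa using exists_cover_of_const x₀ h1
    · exact exists_cover_of_three_le hk3 hl2 hs
        (fun m => ⌈s * ((k - 1) ^ (Fintype.card α - m) : ℕ)⌉₊) (fun m _ => Nat.le_ceil _) hMs
  obtain ⟨η, hη0, hη⟩ : ∃ η : ℝ, 0 < η ∧ ∀ m ∈ range (l + 1),
      ⌈s * ((k - 1) ^ (l - m) : ℕ)⌉₊ ≤ ⌈s * ((k - 1) ^ (l - m) : ℕ) * (1 - η)⌉₊ :=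
    ((eventually_mem_nhdsWithin).and ((Filter.eventually_all_finset _).2 fun m _ =>
      eventually_ceil_le_ceil (hpow m))).exists
  have hmem : ∀ Y i, i ∈ (f Y).image (fun b : Fin M => (b : ℕ) + 1) → i ∈ Icc 1 M := by
    intro Y i hi
    obtain ⟨b, -, rfl⟩ := mem_image.1 hi
    rw [mem_Icc]
    have := b.isLt
    omega
  refine ⟨η, fun Y => (f Y).image fun b : Fin M => (b : ℕ) + 1, hη0, hmem, fun Y => ?_, fun x => ?_⟩
  · have hY : Y.card ≤ l := hl ▸ card_le_univ Y
    rw [hq _ hY]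
    exact card_image_le.trans ((hf1 Y).trans (hη _ (mem_range.2 (by omega))))
  · ext i
    rw [mem_biUnion]
    constructor
    · rintro ⟨Y, -, hi⟩
      exact hmem Y i hi
    · intro hi
      rw [mem_Icc] at hi
      obtain ⟨Y, hxY, hb⟩ := hf2 x ⟨i - 1, by omega⟩
      refine ⟨Y, by simpa using hxY, mem_image.2 ⟨_, hb, ?_⟩⟩
      exact Nat.sub_add_cancel hi.1
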